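/- arXiv:2002.03365 — 2 statements merged into one kernel-verified Lean document; each statement's English description precedes it below -/
import Mathlib

section
/- Let n ≥ 3, let A be a symmetric n×n real matrix, let R = tr(A), let f be a real number, and set H = (A - (R/n)·I) + f·(A - (R/(n-1))·I) (the pointwise form of the CPE equation ∇²f = Ric̊ + (Ric - (R/(n-1))g)f, with A playing the role of the Ricci tensor and H the Hessian of f). Then ((2-n)/4)·R·tr(H) + ((n-2)/2)·⟨H, A⟩ - 2·(-(1/2)·‖A‖² + (n/(8(n-1)))·R²)·f = ((n-2+n·f)/2)·‖A - (R/n)·I‖², where ⟨·,·⟩ is the Frobenius inner product, ‖·‖ the Frobenius norm, and I the identity matrix. (This is the pointwise algebraic identity underlying the paper's key Lemma: tr Λ*_g(f) = ((n-2+nf)/2)|Ric̊|² for a CPE metric.) -/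
open Matrix

/-- Pointwise algebraic identity underlying the paper's key Lemma:
`tr Λ*_g(f) = ((n-2+nf)/2)|Ric̊|²` for a CPE metric. Here `A` plays the role of
the Ricci tensor, `R = tr A` the scalar curvature, and
`H = (A - (R/n)·I) + f·(A - (R/(n-1))·I)` the Hessian of `f` given by the CPE
equation. The Frobenius inner product is `⟨X,Y⟩ = tr (Xᵀ * Y)`. -/
theorem stmt_0 (n : ℕ) (hn : 3 ≤ n)
    (A : Matrix (Fin n) (Fin n) ℝ) (hA : A.IsSymm)
    (R f : ℝ) (hR : R = A.trace)
    (H : Matrix (Fin n) (Fin n) ℝ)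
    (hH : H = (A - (R / n) • (1 : Matrix (Fin n) (Fin n) ℝ))
            + f • (A - (R / ((n : ℝ) - 1)) • (1 : Matrix (Fin n) (Fin n) ℝ))) :
    ((2 - (n : ℝ)) / 4) * R * H.trace
      + (((n : ℝ) - 2) / 2) * (Hᵀ * A).trace
      - 2 * (-(1 / 2) * (Aᵀ * A).trace + ((n : ℝ) / (8 * ((n : ℝ) - 1))) * R ^ 2) * f
    = (((n : ℝ) - 2 + (n : ℝ) * f) / 2)
      * ((A - (R / n) • (1 : Matrix (Fin n) (Fin n) ℝ))ᵀ
        * (A - (R / n) • (1 : Matrix (Fin n) (Fin n) ℝ))).trace := by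
  have hn' : (3 : ℝ) ≤ n := by exact_mod_cast hn
  have h0 : (n : ℝ) ≠ 0 := by linarith
  have h1 : (n : ℝ) - 1 ≠ 0 := by linarith
  subst hH
  simp only [transpose_add, transpose_sub, transpose_smul, transpose_one, hA.eq, add_mul, sub_mul,
    mul_sub, smul_mul_assoc, mul_smul_comm, one_mul, mul_one, trace_add, trace_sub, trace_smul,
    trace_one, Fintype.card_fin, smul_eq_mul, ← hR]
  field_simp
  ring
end

section
/- Let n ≥ 3, let A be a symmetric n×n real matrix, let R = tr(A), let f be a real number, and set H = f·(A - (R/(n-1))·I) (the pointwise form of the vacuum static equation ∇²f = (Ric - (R/(n-1))g)f, with A playing the role of the Ricci tensor and H the Hessian of f). Then ((2-n)/4)·R·tr(H) + ((n-2)/2)·⟨H, A⟩ - 2·(-(1/2)·‖A‖² + (n/(8(n-1)))·R²)·f = (n/2)·‖A - (R/n)·I‖²·f, where ⟨·,·⟩ is the Frobenius inner product, ‖·‖ the Frobenius norm, and I the identity matrix. (This is the pointwise algebraic identity underlying the paper's computation tr Λ*_g(f) = (n/2)|Ric_g - (R_g/n)g|²·f for a vacuum static space.) -/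
open Matrix

/-- Pointwise algebraic identity underlying the paper's computation
`tr Λ*_g(f) = (n/2)|Ric_g - (R_g/n)g|²·f` for a vacuum static space. Here `A`
plays the role of the Ricci tensor, `R = tr A`, and `H = f·(A - (R/(n-1))·I)`
is the Hessian of `f` given by the vacuum static equation. The Frobenius inner
product is `⟨X,Y⟩ = tr (Xᵀ * Y)`. -/
theorem stmt_1 (n : ℕ) (hn : 3 ≤ n)
    (A : Matrix (Fin n) (Fin n) ℝ) (hA : A.IsSymm)
    (R f : ℝ) (hR : R = A.trace)
    (H : Matrix (Fin n) (Fin n) ℝ)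
    (hH : H = f • (A - (R / ((n : ℝ) - 1)) • (1 : Matrix (Fin n) (Fin n) ℝ))) :
    ((2 - (n : ℝ)) / 4) * R * H.trace
      + (((n : ℝ) - 2) / 2) * (Hᵀ * A).trace
      - 2 * (-(1 / 2) * (Aᵀ * A).trace + ((n : ℝ) / (8 * ((n : ℝ) - 1))) * R ^ 2) * f
    = ((n : ℝ) / 2)
      * ((A - (R / n) • (1 : Matrix (Fin n) (Fin n) ℝ))ᵀ
        * (A - (R / n) • (1 : Matrix (Fin n) (Fin n) ℝ))).trace * f := by
  have hn0 : (n : ℝ) ≠ 0 := by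
    have : n ≠ 0 := by omega
    exact_mod_cast this
  have hn1 : (n : ℝ) - 1 ≠ 0 := by
    have : (n : ℝ) ≠ 1 := by exact_mod_cast (by omega : n ≠ 1)
    exact sub_ne_zero.mpr this
  have hAT : Aᵀ = A := hA
  have htrH : H.trace = f * (R - R / ((n : ℝ) - 1) * n) := by
    simp [hH, hR]
  have hHA : (Hᵀ * A).trace = f * ((A * A).trace - R / ((n : ℝ) - 1) * R) := by
    simp [hH, hR, hAT, sub_mul]
  have hsq : ((A - (R / n) • (1 : Matrix (Fin n) (Fin n) ℝ))ᵀ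
      * (A - (R / n) • (1 : Matrix (Fin n) (Fin n) ℝ))).trace
      = (A * A).trace - 2 * (R / n) * R + (R / n) ^ 2 * n := by
    simp only [transpose_sub, transpose_smul, transpose_one, hAT, sub_mul, mul_sub,
      smul_mul_assoc, mul_smul_comm, one_mul, mul_one, trace_sub, trace_smul, trace_one,
      Fintype.card_fin, smul_eq_mul, ← hR]
    ring
  rw [htrH, hHA, hsq, hAT]
  field_simp
  ring
end
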